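/- arXiv:1908.06333 — 2 statements merged into one kernel-verified Lean document; each statement's English description precedes it below -/
import Mathlib

section
/- Let r = r(n) ≥ 3 be an integer-valued function with r = o(n^{1/2}) as n → ∞, let p = p(n) ∈ [0,1] with r^{-2} n ≤ Np = o(r^{-3} n^{3/2}), and write q = 1 − p. Let X have the binomial distribution Bin(N, p). Then, uniformly over all integers t with −log(r^{-2}n)·√(Npq) − [r]_2^2 (Np)^2 / (2n^2) ≤ t ≤ log(r^{-2}n)·√(Npq), we have P[ X = ⌊Np⌋ + t ] = (1/√(2π Np)) · exp[ −t^2 / (2Np) + O( (log(r^{-2}n))^3 / √(Np) + r^6 (Np)^2 / n^3 ) ]. -/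
open Filter Finset Real

/-- The probability that a `Bin(N,p)` random variable equals the integer `k`. -/
noncomputable def binomProb (N : ℕ) (p : ℝ) (k : ℤ) : ℝ :=
  if 0 ≤ k ∧ k ≤ (N : ℤ) then
    (N.choose k.toNat : ℝ) * p ^ k.toNat * (1 - p) ^ (N - k.toNat)
  else 0

/-- The expected number of successes `m₀ = N p`, with `N = C(n, r(n))`. -/
noncomputable def expSucc (r : ℕ → ℕ) (p : ℕ → ℝ) (n : ℕ) : ℝ :=
  (n.choose (r n) : ℝ) * p n

theorem pow_le_pow_mul_choose (r : ℕ) : ∀ n : ℕ, r ≤ n → n ^ r ≤ r ^ r * n.choose r := by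
  induction r with
  | zero => simp
  | succ r ih =>
    rintro (_ | n) hn
    · omega
    have hrn : r ≤ n := by omega
    have key : (n + 1) ^ r ≤ (r + 1) ^ r * n.choose r := by
      rcases Nat.eq_zero_or_pos r with rfl | hr
      · simp
      refine le_of_mul_le_mul_left (a := r ^ r) ?_ (Nat.pow_pos hr)
      calc r ^ r * (n + 1) ^ r = (r * (n + 1)) ^ r := by rw [mul_pow]
        _ ≤ ((r + 1) * n) ^ r := Nat.pow_le_pow_left (by nlinarith) r
        _ = (r + 1) ^ r * n ^ r := by rw [mul_pow]
        _ ≤ (r + 1) ^ r * (r ^ r * n.choose r) := by gcongr; exact ih n hrn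
        _ = r ^ r * ((r + 1) ^ r * n.choose r) := by ring
    calc (n + 1) ^ (r + 1) = (n + 1) * (n + 1) ^ r := by ring
      _ ≤ (n + 1) * ((r + 1) ^ r * n.choose r) := by gcongr
      _ = (r + 1) ^ r * ((n + 1) * n.choose r) := by ring
      _ = (r + 1) ^ r * ((n + 1).choose (r + 1) * (r + 1)) := by rw [Nat.add_one_mul_choose_eq]
      _ = (r + 1) ^ (r + 1) * (n + 1).choose (r + 1) := by ring

theorem cube_le_pow_six_mul_choose {n r : ℕ} (hr : 3 ≤ r) (hrn : r ≤ n) :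
    (n : ℝ) ^ 3 ≤ (r : ℝ) ^ 6 * n.choose r := by
  have h : (n : ℝ) ^ r ≤ (r : ℝ) ^ r * n.choose r := by
    exact_mod_cast pow_le_pow_mul_choose r n hrn
  have hr0 : (1 : ℝ) ≤ r := by exact_mod_cast (by omega : 1 ≤ r)
  have hrn' : (r : ℝ) ≤ n := by exact_mod_cast hrn
  obtain ⟨d, rfl⟩ := Nat.exists_eq_add_of_le hr
  generalize hR : ((3 + d : ℕ) : ℝ) = R at *
  have hd : R ^ d ≤ (n : ℝ) ^ d := by gcongr
  have hRd : 0 < R ^ d := by positivity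
  have h2 : (n : ℝ) ^ 3 ≤ R ^ 3 * n.choose (3 + d) := by
    refine le_of_mul_le_mul_left ?_ hRd
    calc R ^ d * (n : ℝ) ^ 3 ≤ (n : ℝ) ^ d * (n : ℝ) ^ 3 := by gcongr
      _ = (n : ℝ) ^ (3 + d) := by ring
      _ ≤ _ := h
      _ = _ := by ring
  refine h2.trans ?_
  have : R ^ 3 ≤ R ^ 6 := pow_le_pow_right₀ hr0 (by norm_num)
  gcongr

theorem log_stirlingSeq_le {n : ℕ} (hn : n ≠ 0) :
    log (Stirling.stirlingSeq n) ≤ log π / 2 + 1 / (12 * n) := by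
  have hmono : Monotone fun n : ℕ =>
      log (Stirling.stirlingSeq (n + 1)) - 1 / (12 * ((n : ℝ) + 1)) := by
    refine monotone_nat_of_le_succ fun n => ?_
    have h := Stirling.log_stirlingSeq_sdiff_le (n + 1)
    push_cast at h ⊢
    have e : 1 / (12 * ((n : ℝ) + 1) * ((n : ℝ) + 1 + 1))
        = 1 / (12 * ((n : ℝ) + 1)) - 1 / (12 * ((n : ℝ) + 1 + 1)) := by
      field_simp
      ring
    linarith
  have hlim : Tendsto (fun n : ℕ =>
      log (Stirling.stirlingSeq (n + 1)) - 1 / (12 * ((n : ℝ) + 1))) atTop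
      (nhds (log (√π) - 12⁻¹ * 0)) := by
    refine Tendsto.sub ?_ ?_
    · exact ((continuousAt_log (by positivity)).tendsto.comp
        Stirling.tendsto_stirlingSeq_sqrt_pi).comp (tendsto_add_atTop_nat 1)
    · refine (tendsto_one_div_add_atTop_nhds_zero_nat.const_mul (12⁻¹ : ℝ)).congr fun n => ?_
      field_simp
  obtain ⟨m, rfl⟩ := Nat.exists_eq_succ_of_ne_zero hn
  have h := hmono.ge_of_tendsto hlim m
  rw [log_sqrt pi_pos.le] at h
  push_cast
  simp only [Nat.succ_eq_add_one] at h ⊢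
  linarith

theorem abs_log_factorial_sub_stirling_le {k : ℕ} (hk : k ≠ 0) :
    |log (k.factorial : ℝ) - (k * log k - k + log (2 * π * k) / 2)| ≤ 1 / k := by
  have hk0 : (0 : ℝ) < k := by positivity
  have h1 := Stirling.le_log_factorial_stirling hk
  have h2 := log_stirlingSeq_le hk
  rw [Stirling.log_stirlingSeq_formula, log_div hk0.ne' (by positivity), log_exp,
    log_mul (by norm_num) hk0.ne'] at h2
  rw [log_mul (by positivity) hk0.ne']
  have h3 : log (2 * π) = log 2 + log π := log_mul (by norm_num) pi_ne_zero
  have h4 : 1 / (12 * (k : ℝ)) ≤ 1 / k := by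
    gcongr
    linarith
  have h5 : 0 ≤ 1 / (k : ℝ) := by positivity
  rw [abs_le]
  constructor
  · linarith
  · linarith

theorem abs_log_one_add_sub_le {u : ℝ} (hu : |u| ≤ 1 / 2) :
    |log (1 + u) - u + u ^ 2 / 2| ≤ 2 * |u| ^ 3 := by
  have h := abs_log_sub_add_sum_range_le (x := -u) (by rw [abs_neg]; linarith) 2
  simp only [Finset.sum_range_succ, Finset.sum_range_zero, abs_neg] at h
  norm_num at h
  have e : log (1 + u) - u + u ^ 2 / 2 = -u + u ^ 2 / 2 + log (1 + u) := by ring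
  rw [e]
  refine h.trans ?_
  rw [div_le_iff₀ (by linarith)]
  nlinarith [pow_nonneg (abs_nonneg u) 3]

theorem abs_log_one_add_le {u : ℝ} (hu : |u| ≤ 1 / 2) : |log (1 + u)| ≤ 2 * |u| := by
  have h := abs_log_sub_add_sum_range_le (x := -u) (by rw [abs_neg]; linarith) 0
  simp only [Finset.sum_range_zero, abs_neg] at h
  norm_num at h
  refine h.trans ?_
  rw [div_le_iff₀ (by linarith)]
  nlinarith [abs_nonneg u]

/-- Second-order expansion of the Poisson rate function around its mean. -/
theorem abs_poisson_exponent_sub_gaussian_le {m k : ℝ} (hm : 0 < m) (hk : |k - m| ≤ m / 2) :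
    |(k * log m - m - (k * log k - k + log (2 * π * k) / 2))
      - (-log (2 * π * m) / 2 - (k - m) ^ 2 / (2 * m))|
      ≤ 4 * |k - m| ^ 3 / m ^ 2 + |k - m| / m := by
  obtain ⟨u, rfl⟩ : ∃ u, k = m * (1 + u) := ⟨k / m - 1, by field_simp; ring⟩
  have e : m * (1 + u) - m = m * u := by ring
  rw [e] at hk ⊢
  rw [abs_mul, abs_of_pos hm] at *
  have hu : |u| ≤ 1 / 2 := by
    refine le_of_mul_le_mul_left ?_ hm
    linarith
  have hu' := abs_le.1 hu
  have hu1 : 0 < 1 + u := by linarith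
  have h1 := abs_log_one_add_sub_le hu
  have h2 := abs_log_one_add_le hu
  rw [log_mul hm.ne' hu1.ne', log_mul (by positivity) (by positivity),
    log_mul (by positivity) hm.ne', log_mul hm.ne' hu1.ne']
  have e2 : m * (1 + u) * log m - m - (m * (1 + u) * (log m + log (1 + u)) - m * (1 + u)
        + (log (2 * π) + (log m + log (1 + u))) / 2)
      - (-(log (2 * π) + log m) / 2 - (m * u) ^ 2 / (2 * m))
      = -(m * ((1 + u) * (log (1 + u) - u + u ^ 2 / 2) - u ^ 3 / 2)) - log (1 + u) / 2 := by
    field_simp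
    ring
  have e3 : 4 * (m * |u|) ^ 3 / m ^ 2 + m * |u| / m = m * (4 * |u| ^ 3) + |u| := by
    field_simp
  rw [e2, e3]
  have h3 : |(1 + u) * (log (1 + u) - u + u ^ 2 / 2) - u ^ 3 / 2| ≤ 4 * |u| ^ 3 := by
    refine (abs_sub _ _).trans ?_
    rw [abs_mul, abs_div, abs_pow, abs_of_pos hu1, abs_two]
    nlinarith [pow_nonneg (abs_nonneg u) 3, abs_nonneg (log (1 + u) - u + u ^ 2 / 2)]
  refine (abs_sub _ _).trans ?_
  rw [abs_neg, abs_mul, abs_of_pos hm, abs_div, abs_two]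
  have := mul_le_mul_of_nonneg_left h3 hm.le
  linarith

/-- Quantitative Poisson approximation of a binomial probability. -/
theorem abs_log_binomial_sub_poisson_le {N k : ℕ} {p : ℝ} (hp : 0 < p) (hp2 : p ≤ 1 / 2)
    (hk : 0 < k) (hkN : 2 * k ≤ N) :
    |log ((N.choose k : ℝ) * p ^ k * (1 - p) ^ (N - k))
      - (k * log (N * p) - N * p - log (k.factorial : ℝ))|
      ≤ 2 * (k : ℝ) ^ 2 / N + k * p + 2 * (N * p ^ 2) := by
  have hN : (0 : ℝ) < N := by exact_mod_cast (by omega : 0 < N)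
  have hk0 : (0 : ℝ) < k := by exact_mod_cast hk
  have hkN' : 2 * (k : ℝ) ≤ N := by exact_mod_cast hkN
  have hq : 0 < 1 - p := by linarith
  have hch : (0 : ℝ) < N.choose k := by exact_mod_cast Nat.choose_pos (by omega)
  have hdf : (N.descFactorial k : ℝ) = k.factorial * N.choose k := by
    exact_mod_cast Nat.descFactorial_eq_factorial_mul_choose N k
  have hd0 : (0 : ℝ) < N.descFactorial k := by rw [hdf]; positivity
  have hlogd : log (N.descFactorial k : ℝ) = log (k.factorial : ℝ) + log (N.choose k : ℝ) := by
    rw [hdf, log_mul (by positivity) hch.ne']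
  have hup : log (N.descFactorial k : ℝ) ≤ k * log N := by
    rw [← log_pow]
    exact log_le_log hd0 (by exact_mod_cast Nat.descFactorial_le_pow N k)
  have hlow : k * log N - 2 * (k : ℝ) ^ 2 / N ≤ log (N.descFactorial k : ℝ) := by
    have h1 : ((N : ℝ) - k) ^ k ≤ N.descFactorial k := by
      have h := Nat.pow_sub_le_descFactorial N k
      have h' : (N - k) ^ k ≤ N.descFactorial k :=
        (Nat.pow_le_pow_left (by omega) k).trans h
      rw [← Nat.cast_sub (by omega)]
      exact_mod_cast h'
    have hNk : 0 < (N : ℝ) - k := by linarith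
    have h2 := log_le_log (by positivity) h1
    rw [log_pow] at h2
    have hu : |-((k : ℝ) / N)| ≤ 1 / 2 := by
      rw [abs_neg, abs_of_pos (by positivity), div_le_iff₀ hN]
      linarith
    have h3 := (abs_le.1 (abs_log_one_add_le hu)).1
    rw [abs_neg, abs_of_pos (by positivity : 0 < (k : ℝ) / N)] at h3
    have h4 : log ((N : ℝ) - k) = log N + log (1 + -((k : ℝ) / N)) := by
      rw [← log_mul hN.ne' ?_]
      · congr 1
        field_simp
        ring
      · have := (abs_le.1 hu).1
        linarith
    rw [h4] at h2
    have h5 := mul_le_mul_of_nonneg_left h3 hk0.le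
    have h6 : (k : ℝ) * -(2 * (k / N)) = -(2 * (k : ℝ) ^ 2 / N) := by ring
    linarith
  have hqu : log (1 - p) ≤ -p := by
    have := log_le_sub_one_of_pos hq
    linarith
  have hql : -p - 2 * p ^ 2 ≤ log (1 - p) := by
    have h := abs_log_sub_add_sum_range_le (x := p) (by rw [abs_of_pos hp]; linarith) 1
    simp only [Finset.sum_range_succ, Finset.sum_range_zero, abs_of_pos hp] at h
    norm_num at h
    have h2 : p ^ 2 / (1 - p) ≤ 2 * p ^ 2 := by
      rw [div_le_iff₀ hq]
      nlinarith [sq_nonneg p]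
    have h3 := (abs_le.1 (h.trans h2)).1
    linarith
  rw [log_mul (by positivity) (by positivity), log_mul hch.ne' (by positivity), log_pow, log_pow,
    Nat.cast_sub (by omega), log_mul hN.ne' hp.ne']
  have hNk : 0 ≤ (N : ℝ) - k := by linarith
  have h1 := mul_le_mul_of_nonneg_left hqu hNk
  have h2 := mul_le_mul_of_nonneg_left hql hNk
  have h3 : 0 ≤ N * p ^ 2 := by positivity
  have h4 : 0 ≤ 2 * (k : ℝ) ^ 2 / N := by positivity
  have h5 : 0 ≤ k * p := by positivity
  have h6 : 0 ≤ k * p ^ 2 := by positivity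
  rw [abs_le]
  constructor
  · nlinarith
  · nlinarith

/-- Local limit theorem for `Bin(N, p)` with mean `m = N p`, in terms of parameters `s` and `L`
controlling the size of the deviation `t`. -/
theorem exists_err_binomProb {N : ℕ} {p m s L : ℝ} {t : ℤ} (hm : m = N * p) (hm0 : 0 < m)
    (hs : 0 < s) (hL : 1 ≤ L) (hsm : 1 ≤ s * m) (hsN : 1 ≤ s ^ 3 * N)
    (hE : L ^ 3 / √m + s ^ 3 * m ^ 2 ≤ 1 / 8) (ht : |(t : ℝ)| ≤ L * √m + s ^ 2 * m ^ 2 / 2) :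
    ∃ err : ℝ, binomProb N p (⌊m⌋ + t)
        = (1 / √(2 * π * m)) * exp (-(t : ℝ) ^ 2 / (2 * m) + err) ∧
      |err| ≤ 200 * (L ^ 3 / √m + s ^ 3 * m ^ 2) := by
  have hN : (0 : ℝ) < N := by
    by_contra h
    have : s ^ 3 * N ≤ 0 := mul_nonpos_of_nonneg_of_nonpos (by positivity) (not_lt.1 h)
    linarith
  have hp : 0 < p := by
    rw [hm] at hm0
    exact pos_of_mul_pos_right hm0 hN.le
  have hsq : √m ^ 2 = m := sq_sqrt hm0.le
  have hsq0 : 0 < √m := sqrt_pos.2 hm0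
  set e := L ^ 3 / √m with he
  set δ := s ^ 3 * m ^ 2 with hδ
  have he0 : 0 < e := by positivity
  have hδ0 : 0 < δ := by positivity
  have hL3 : L ≤ L ^ 3 := le_self_pow₀ hL (by norm_num)
  have hL31 : 1 ≤ L ^ 3 := hL.trans hL3
  have hsq8 : 8 ≤ √m := by
    have h : e ≤ 1 / 8 := by linarith
    rw [he, div_le_iff₀ hsq0] at h
    linarith
  have hm1 : 1 ≤ m := by nlinarith
  have hae : L * √m ≤ m * e := by
    have : m * e = L ^ 3 * √m := by
      rw [he, ← hsq]
      field_simp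
      rw [sqrt_sq hsq0.le]
    rw [this]
    gcongr
  have ha1 : 1 ≤ L * √m := by nlinarith
  have hb : s ^ 2 * m ^ 2 ≤ m * δ := by
    have : m * δ = s ^ 2 * m ^ 2 * (s * m) := by rw [hδ]; ring
    rw [this]
    exact le_mul_of_one_le_right (by positivity) hsm
  have hmN : m ^ 2 / N ≤ δ := by
    rw [div_le_iff₀ hN]
    have : δ * N = m ^ 2 * (s ^ 3 * N) := by rw [hδ]; ring
    rw [this]
    exact le_mul_of_one_le_right (by positivity) hsN
  have hpm : p = m / N := by rw [hm]; field_simp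
  have hp8 : p ≤ 1 / 8 := by
    have h : p ≤ m ^ 2 / N := by
      rw [hpm]
      gcongr
      nlinarith
    linarith
  -- the deviation of the integer point from the mean
  obtain ⟨z, hz⟩ : ∃ z : ℤ, z = ⌊m⌋ + t := ⟨_, rfl⟩
  have hzr : (z : ℝ) = ⌊m⌋ + t := by exact_mod_cast hz
  have hf1 := Int.floor_le m
  have hf2 := Int.lt_floor_add_one m
  have htt := abs_le.1 ht
  have hx : |(z : ℝ) - m| ≤ 2 * (L * √m) + s ^ 2 * m ^ 2 / 2 := by
    rw [abs_le, hzr]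
    constructor <;> linarith
  have hxm : |(z : ℝ) - m| ≤ m * (2 * e + δ / 2) := by linarith
  have hxm2 : |(z : ℝ) - m| ≤ m / 2 := by
    have := mul_le_mul_of_nonneg_left (by linarith : 2 * e + δ / 2 ≤ 1 / 2) hm0.le
    linarith
  have hx' := abs_le.1 hxm2
  have hz0 : (0 : ℝ) < z := by linarith
  obtain ⟨k, rfl⟩ : ∃ k : ℕ, z = k := Int.eq_ofNat_of_zero_le (by exact_mod_cast hz0.le)
  simp only [Int.cast_natCast] at *
  have hk : 0 < k := by exact_mod_cast hz0
  have hkN : 2 * k ≤ N := by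
    have : 2 * (k : ℝ) ≤ N := by
      have : m ≤ N * (1 / 8) := by rw [hm]; gcongr
      linarith
    exact_mod_cast this
  have hbin : binomProb N p (⌊m⌋ + t) = (N.choose k : ℝ) * p ^ k * (1 - p) ^ (N - k) := by
    rw [binomProb, ← hz, if_pos (by omega), Int.toNat_natCast]
  have hpos : 0 < (N.choose k : ℝ) * p ^ k * (1 - p) ^ (N - k) := by
    have : (0 : ℝ) < N.choose k := by exact_mod_cast Nat.choose_pos (by omega)
    have : 0 < 1 - p := by linarith
    positivity
  have h1 := abs_log_binomial_sub_poisson_le hp (by linarith) hk hkN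
  have h2 := abs_log_factorial_sub_stirling_le hk.ne'
  have h3 := abs_poisson_exponent_sub_gaussian_le hm0 hxm2
  rw [← hm] at h1
  have h4 : |((k : ℝ) - m) ^ 2 / (2 * m) - (t : ℝ) ^ 2 / (2 * m)| ≤ 2 * e + δ := by
    have ew : ((k : ℝ) - m) ^ 2 / (2 * m) - (t : ℝ) ^ 2 / (2 * m)
        = ((k - m - t) * (2 * t + (k - m - t))) / (2 * m) := by ring
    have hw : |(k : ℝ) - m - t| ≤ 1 := by
      rw [abs_le, hzr]
      constructor <;> linarith
    have hw2 : |2 * (t : ℝ) + (k - m - t)| ≤ 2 * (m * e + m * δ / 2) + m * e := by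
      refine (abs_add_le _ _).trans ?_
      rw [abs_mul, abs_two]
      linarith
    rw [ew, abs_div, abs_of_pos (by positivity : 0 < 2 * m), div_le_iff₀ (by positivity), abs_mul]
    have hmul := mul_le_mul hw hw2 (abs_nonneg _) zero_le_one
    have hme := mul_pos hm0 he0
    have hmd := mul_pos hm0 hδ0
    linarith
  have h5 : 2 * (k : ℝ) ^ 2 / N + k * p + 2 * (N * p ^ 2) ≤ 8 * δ := by
    have hk2 : (k : ℝ) ≤ 3 / 2 * m := by linarith
    have e1 : 2 * (k : ℝ) ^ 2 / N ≤ 2 * (3 / 2 * m) ^ 2 / N := by gcongr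
    have e2 : k * p ≤ 3 / 2 * m * p := by gcongr
    have e3 : 2 * (3 / 2 * m) ^ 2 / N + 3 / 2 * m * p + 2 * (N * p ^ 2) = 8 * (m ^ 2 / N) := by
      rw [hpm]
      field_simp
      ring
    linarith
  have h6 : 1 / (k : ℝ) ≤ 2 * e := by
    rw [div_le_iff₀ hz0]
    have := mul_le_mul_of_nonneg_left (by linarith : m / 2 ≤ k) he0.le
    linarith
  have h7 : |(k : ℝ) - m| / m ≤ 2 * e + δ / 2 := by
    rw [div_le_iff₀ hm0]
    linarith
  have h8 : 4 * |(k : ℝ) - m| ^ 3 / m ^ 2 ≤ 128 * e + δ := by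
    rw [div_le_iff₀ (by positivity)]
    have hcub : |(k : ℝ) - m| ^ 3 ≤ 4 * ((2 * (L * √m)) ^ 3 + (s ^ 2 * m ^ 2 / 2) ^ 3) :=
      (pow_le_pow_left₀ (abs_nonneg _) hx 3).trans
        ((add_pow_le (by positivity) (by positivity) 3).trans_eq (by norm_num))
    have e1 : (L * √m) ^ 3 = e * m ^ 2 := by
      have : m ^ 2 = √m ^ 4 := by rw [← hsq, sqrt_sq hsq0.le]; ring
      rw [he, this]
      field_simp
    have e2 : (s ^ 2 * m ^ 2) ^ 3 = δ ^ 2 * m ^ 2 := by rw [hδ]; ring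
    have e3 : δ ^ 2 * m ^ 2 ≤ 1 / 8 * δ * m ^ 2 := by
      gcongr
      rw [sq]
      gcongr
      linarith
    have e4 : 0 < δ * m ^ 2 := by positivity
    rw [mul_pow, e1, div_pow, e2] at hcub
    linarith
  refine ⟨log ((N.choose k : ℝ) * p ^ k * (1 - p) ^ (N - k)) + log (2 * π * m) / 2
    + (t : ℝ) ^ 2 / (2 * m), ?_, ?_⟩
  · rw [hbin]
    have hpm : 0 < 2 * π * m := by positivity
    have e1 : 1 / √(2 * π * m) = exp (-(log (2 * π * m) / 2)) := by
      rw [← log_sqrt hpm.le, exp_neg, exp_log (sqrt_pos.2 hpm), one_div]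
    rw [e1, ← exp_add]
    conv_lhs => rw [← exp_log hpos]
    congr 1
    ring
  · have h1' := abs_le.1 h1
    have h2' := abs_le.1 h2
    have h3' := abs_le.1 h3
    have h4' := abs_le.1 h4
    rw [abs_le]
    constructor <;> linarith

theorem tendsto_log_pow_three_div_sqrt :
    Tendsto (fun x : ℝ => log x ^ 3 / √x) atTop (nhds 0) := by
  have h := (isLittleO_pow_log_id_atTop (n := 3)).comp_tendsto tendsto_sqrt_atTop
  have h2 := (h.tendsto_div_nhds_zero).const_mul 8
  rw [mul_zero] at h2
  refine h2.congr' ?_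
  filter_upwards [eventually_gt_atTop 0] with x hx
  simp only [Function.comp, id, log_sqrt hx.le]
  ring

/-- **Lemma 9.4**: local normal approximation for `Bin(N,p)` with `N = C(n,r)`,
`r = o(n^{1/2})` and `r⁻²n ≤ Np = o(r⁻³n^{3/2})`, uniformly over
`t ∈ [-log(r⁻²n)√(Npq) - [r]₂²(Np)²/(2n²), log(r⁻²n)√(Npq)]`. -/
theorem statement18 (r : ℕ → ℕ) (p : ℕ → ℝ) (hr : ∀ n, 3 ≤ r n)
    (hp0 : ∀ n, 0 ≤ p n) (hp1 : ∀ n, p n ≤ 1)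
    (hro : (fun n => (r n : ℝ)) =o[atTop] (fun n => (n : ℝ) ^ ((1 : ℝ) / 2)))
    (hlb : ∀ᶠ n : ℕ in atTop, (n : ℝ) / (r n : ℝ) ^ 2 ≤ expSucc r p n)
    (hsmall : (fun n => expSucc r p n) =o[atTop]
      (fun n => (n : ℝ) ^ ((3 : ℝ) / 2) / (r n : ℝ) ^ 3)) :
    ∃ C > (0 : ℝ), ∃ n₀ : ℕ, ∀ n ≥ n₀, ∀ t : ℤ,
      -(Real.log ((n : ℝ) / (r n : ℝ) ^ 2)
            * Real.sqrt (expSucc r p n * (1 - p n)))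
          - ((r n).descFactorial 2 : ℝ) ^ 2 * (expSucc r p n) ^ 2 / (2 * (n : ℝ) ^ 2)
        ≤ (t : ℝ) →
      (t : ℝ) ≤ Real.log ((n : ℝ) / (r n : ℝ) ^ 2)
          * Real.sqrt (expSucc r p n * (1 - p n)) →
      ∃ err : ℝ,
        binomProb (n.choose (r n)) (p n) (⌊expSucc r p n⌋ + t)
          = (1 / Real.sqrt (2 * π * expSucc r p n))
            * Real.exp (-(t : ℝ) ^ 2 / (2 * expSucc r p n) + err) ∧
        |err| ≤ C * ((Real.log ((n : ℝ) / (r n : ℝ) ^ 2)) ^ 3 / Real.sqrt (expSucc r p n)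
          + (r n : ℝ) ^ 6 * (expSucc r p n) ^ 2 / (n : ℝ) ^ 3) := by
  have hA : Tendsto (fun n : ℕ => (n : ℝ) / (r n : ℝ) ^ 2) atTop atTop := by
    have h := (hro.tendsto_div_nhds_zero).pow 2
    have h' : Tendsto (fun n : ℕ => (r n : ℝ) ^ 2 / n) atTop (nhdsWithin 0 (Set.Ioi 0)) := by
      refine tendsto_nhdsWithin_iff.2 ⟨?_, ?_⟩
      · rw [zero_pow two_ne_zero] at h
        refine h.congr fun n => ?_
        rw [div_pow, ← sqrt_eq_rpow, sq_sqrt (Nat.cast_nonneg n)]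
      · filter_upwards [eventually_gt_atTop 0] with n hn
        have : (0 : ℝ) < n := by exact_mod_cast hn
        have : (0 : ℝ) < r n := by exact_mod_cast (by linarith [hr n] : 0 < r n)
        change (0 : ℝ) < (r n : ℝ) ^ 2 / n
        positivity
    refine h'.inv_tendsto_nhdsGT_zero.congr fun n => ?_
    simp
  have hδ : Tendsto (fun n : ℕ => (r n : ℝ) ^ 6 * (expSucc r p n) ^ 2 / (n : ℝ) ^ 3) atTop
      (nhds 0) := by
    have h := (hsmall.tendsto_div_nhds_zero).pow 2
    rw [zero_pow two_ne_zero] at h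
    refine h.congr fun n => ?_
    have e : ((n : ℝ) ^ ((3 : ℝ) / 2)) ^ 2 = (n : ℝ) ^ 3 := by
      rw [← rpow_natCast, ← rpow_mul (Nat.cast_nonneg n), ← rpow_natCast]
      norm_num
    rw [div_pow, div_pow, e, div_div_eq_mul_div]
    ring
  have hlog := tendsto_log_pow_three_div_sqrt.comp hA
  have h16 : (0 : ℝ) < 1 / 16 := by norm_num
  obtain ⟨n₀, hn₀⟩ := eventually_atTop.1 ((hA.eventually_ge_atTop (exp 1)).and
    (hlb.and ((hδ.eventually_le_const h16).and ((hlog.eventually_le_const h16).and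
      (eventually_gt_atTop 0)))))
  refine ⟨200, by norm_num, n₀, fun n hn t htl htu => ?_⟩
  obtain ⟨hA1, hlb, hδ, hlog, hn0⟩ := hn₀ n hn
  simp only [Function.comp] at hlog
  have hr3 := hr n
  have hn' : (0 : ℝ) < n := by exact_mod_cast hn0
  have hr' : (0 : ℝ) < r n := by exact_mod_cast (by omega : 0 < r n)
  have hA0 : 0 < (n : ℝ) / (r n : ℝ) ^ 2 := by positivity
  have hL : 1 ≤ log ((n : ℝ) / (r n : ℝ) ^ 2) := (le_log_iff_exp_le hA0).2 hA1
  set m := expSucc r p n with hm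
  set L := log ((n : ℝ) / (r n : ℝ) ^ 2) with hLdef
  have hm0 : 0 < m := hA0.trans_le hlb
  have hδe : (r n : ℝ) ^ 6 * m ^ 2 / (n : ℝ) ^ 3 = ((r n : ℝ) ^ 2 / n) ^ 3 * m ^ 2 := by
    rw [div_pow]
    ring
  have hrn : r n ≤ n := by
    have h : 1 ≤ (n : ℝ) / (r n : ℝ) ^ 2 := (one_le_exp (zero_le_one' ℝ)).trans hA1
    rw [le_div_iff₀ (by positivity), one_mul] at h
    have h' : r n ^ 2 ≤ n := by exact_mod_cast h
    nlinarith
  rw [hδe]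
  rw [hδe] at hδ
  refine exists_err_binomProb rfl hm0 (by positivity) hL ?_ ?_ ?_ ?_
  · rw [div_le_iff₀ (by positivity)] at hlb
    rw [div_mul_eq_mul_div, le_div_iff₀ hn']
    linarith
  · rw [div_pow, div_mul_eq_mul_div, le_div_iff₀ (by positivity), ← pow_mul, one_mul]
    exact cube_le_pow_six_mul_choose hr3 hrn
  · have : L ^ 3 / √m ≤ L ^ 3 / √((n : ℝ) / (r n : ℝ) ^ 2) := by gcongr
    linarith
  · have h1 : √(m * (1 - p n)) ≤ √m :=
      sqrt_le_sqrt (mul_le_of_le_one_right hm0.le (by linarith [hp0 n]))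
    have h2 : L * √(m * (1 - p n)) ≤ L * √m := by gcongr
    have h3 : ((r n).descFactorial 2 : ℝ) ≤ (r n : ℝ) ^ 2 := by
      exact_mod_cast Nat.descFactorial_le_pow (r n) 2
    have h4 : ((r n).descFactorial 2 : ℝ) ^ 2 * m ^ 2 / (2 * (n : ℝ) ^ 2)
        ≤ ((r n : ℝ) ^ 2 / n) ^ 2 * m ^ 2 / 2 := by
      calc _ ≤ ((r n : ℝ) ^ 2) ^ 2 * m ^ 2 / (2 * (n : ℝ) ^ 2) := by gcongr
        _ = _ := by rw [div_pow]; ring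
    have h5 : 0 ≤ ((r n : ℝ) ^ 2 / n) ^ 2 * m ^ 2 / 2 := by positivity
    rw [abs_le]
    constructor <;> linarith
end

section
/- Let r = r(n) ≥ 3 and let p = p(n) ∈ [0,1] with m_0 = Np satisfying 0 < m_0 = O(r^{-2} n) as n → ∞. Then P[ H_r(n,p) is linear ] = exp[ −[r]_2^2 m_0^2 / (4 n^2) + O( r^6 m_0^2 / n^3 ) ]. -/
open Filter Finset

/-- A hypergraph is linear if any two distinct edges share at most one vertex. -/
def IsLinear {n : ℕ} (H : Finset (Finset (Fin n))) : Prop :=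
  ∀ e ∈ H, ∀ f ∈ H, e ≠ f → (e ∩ f).card ≤ 1

instance {n : ℕ} : DecidablePred (IsLinear (n := n)) := fun _ => by
  unfold IsLinear; infer_instance

/-- The probability that the binomial random `r`-graph `H_r(n,p)`, in which each `r`-subset of
`Fin n` is an edge independently with probability `p`, is linear. -/
noncomputable def probLinear (n r : ℕ) (p : ℝ) : ℝ :=
  ∑ H ∈ Finset.univ.filter (fun H : Finset (Finset (Fin n)) =>
      (∀ e ∈ H, e.card = r) ∧ IsLinear H),
    p ^ H.card * (1 - p) ^ (n.choose r - H.card)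

/-- The expected number of edges `m₀ = N p` of `H_r(n,p)`. -/
noncomputable def expEdges (r : ℕ → ℕ) (p : ℕ → ℝ) (n : ℕ) : ℝ :=
  (n.choose (r n) : ℝ) * p n


section IndependencePolynomial

variable {α : Type*} [DecidableEq α] (G : SimpleGraph α) [DecidableRel G.Adj]

/-- The independence polynomial of the subgraph of `G` induced on `A`, evaluated at `x`. -/
noncomputable def indepPoly (A : Finset α) (x : ℝ) : ℝ :=
  ∑ I ∈ A.powerset.filter (fun I : Finset α => G.IsIndepSet (I : Set α)), x ^ #I

lemma indepPoly_insert {A : Finset α} {v : α} (hv : v ∉ A) (x : ℝ) :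
    indepPoly G (insert v A) x =
      indepPoly G A x + x * indepPoly G (A.filter fun u => ¬ G.Adj v u) x := by
  have key : (A.powerset.filter fun I : Finset α => G.IsIndepSet ((insert v I : Finset α) : Set α)) =
      (A.filter fun u => ¬ G.Adj v u).powerset.filter fun I : Finset α => G.IsIndepSet (I : Set α) := by
    ext I
    simp only [mem_filter, mem_powerset, coe_insert, subset_iff]
    constructor
    · rintro ⟨hI, h⟩
      refine ⟨fun u hu => ⟨hI hu, ?_⟩, h.mono (Set.subset_insert _ _)⟩
      exact h (Set.mem_insert _ _) (Set.mem_insert_of_mem _ hu) (fun e => hv (e ▸ hI hu))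
    · rintro ⟨hI, h⟩
      refine ⟨fun u hu => (hI hu).1, ?_⟩
      refine (Set.pairwise_insert).2 ⟨h, fun u hu _ => ⟨(hI hu).2, fun e => (hI hu).2 e.symm⟩⟩
  unfold indepPoly
  rw [sum_filter, sum_powerset_insert hv, ← sum_filter, ← sum_filter, key, mul_sum]
  congr 1
  refine sum_congr rfl fun I hI => ?_
  have : v ∉ I := fun h => hv
    (mem_filter.1 (mem_powerset.1 (mem_filter.1 hI).1 h)).1
  rw [card_insert_of_notMem this, pow_succ']

variable {x : ℝ}

lemma indepPoly_mono (hx : 0 ≤ x) {A B : Finset α} (h : A ⊆ B) :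
    indepPoly G A x ≤ indepPoly G B x :=
  sum_le_sum_of_subset_of_nonneg (filter_subset_filter _ (powerset_mono.2 h))
    fun _ _ _ => pow_nonneg hx _

lemma indepPoly_nonneg (hx : 0 ≤ x) (A : Finset α) : 0 ≤ indepPoly G A x :=
  sum_nonneg fun _ _ => pow_nonneg hx _

lemma indepPoly_sdiff_ge (hx : 0 ≤ x) (A B : Finset α) :
    (1 - #B * x) * indepPoly G A x ≤ indepPoly G (A \ B) x := by
  induction B using Finset.induction with
  | empty => simp
  | insert b B hb ih =>
    rw [card_insert_of_notMem hb, sdiff_insert]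
    by_cases hbA : b ∈ A \ B
    · have h1 := indepPoly_insert G (notMem_erase b (A \ B)) x
      rw [insert_erase hbA] at h1
      have h2 := indepPoly_mono G hx
        ((filter_subset (fun u => ¬ G.Adj b u) ((A \ B).erase b)).trans
          ((erase_subset _ _).trans sdiff_subset) : _ ⊆ A)
      have h3 := mul_le_mul_of_nonneg_left h2 hx
      push_cast
      linarith
    · rw [erase_eq_of_notMem hbA]
      have := mul_nonneg hx (indepPoly_nonneg G hx A)
      push_cast
      linarith

lemma indepPoly_sdiff_le (hx : 0 ≤ x) {A B : Finset α} (hBA : B ⊆ A) {d : ℝ}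
    (hd : ∀ u ∈ B, (#(A.filter (G.Adj u)) : ℝ) ≤ d) :
    indepPoly G (A \ B) x ≤ (1 - #B * x * (1 - (#B + d) * x)) * indepPoly G A x := by
  induction B using Finset.induction with
  | empty => simp
  | insert b B hb ih =>
    have ih := ih ((subset_insert _ _).trans hBA) fun u hu => hd u (mem_insert_of_mem hu)
    have hbA : b ∈ A \ B := Finset.mem_sdiff.2 ⟨hBA (mem_insert_self _ _), hb⟩
    have h1 := indepPoly_insert G (notMem_erase b (A \ B)) x
    rw [insert_erase hbA] at h1
    have h2 : A \ (insert b B ∪ A.filter (G.Adj b)) ⊆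
        ((A \ B).erase b).filter fun u => ¬ G.Adj b u := by
      intro u hu
      simp only [Finset.mem_sdiff, mem_union, mem_insert, mem_filter, mem_erase] at hu ⊢
      tauto
    have h3 := (indepPoly_sdiff_ge G hx A _).trans (indepPoly_mono G hx h2)
    have h4 : (#(insert b B ∪ A.filter (G.Adj b)) : ℝ) ≤ #B + 1 + d := by
      have h5 : (#(insert b B ∪ A.filter (G.Adj b)) : ℝ) ≤
          #(insert b B) + #(A.filter (G.Adj b)) := by
        exact_mod_cast card_union_le _ _
      rw [card_insert_of_notMem hb] at h5
      push_cast at h5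
      linarith [hd b (mem_insert_self _ _)]
    have hA := indepPoly_nonneg G hx A
    have h6 : (1 - (#B + 1 + d) * x) * indepPoly G A x ≤
        (1 - #(insert b B ∪ A.filter (G.Adj b)) * x) * indepPoly G A x := by gcongr
    have h7 := mul_le_mul_of_nonneg_left (h6.trans h3) hx
    rw [sdiff_insert, card_insert_of_notMem hb]
    push_cast
    have h8 : 0 ≤ #B * x * x * indepPoly G A x := by positivity
    linarith

/-- Twice the number of edges of `G` inside `A`. -/
noncomputable def degreeSum (A : Finset α) : ℝ := ∑ v ∈ A, (#(A.filter (G.Adj v)) : ℝ)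

lemma degreeSum_insert {A : Finset α} {v : α} (hv : v ∉ A) :
    degreeSum G (insert v A) = degreeSum G A + 2 * #(A.filter (G.Adj v)) := by
  unfold degreeSum
  rw [sum_insert hv, filter_insert, if_neg G.irrefl]
  have : ∀ u ∈ A, (#((insert v A).filter (G.Adj u)) : ℝ) =
      #(A.filter (G.Adj u)) + if G.Adj v u then 1 else 0 := by
    intro u _
    rw [filter_insert]
    by_cases h : G.Adj u v
    · rw [if_pos h, if_pos h.symm, card_insert_of_notMem (by simp [hv])]
      push_cast
      rfl
    · rw [if_neg h, if_neg fun h' => h h'.symm, add_zero]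
  rw [sum_congr rfl this, sum_add_distrib, sum_boole]
  ring

variable {p : ℝ}

lemma indepPoly_le_exp (hp0 : 0 ≤ p) (hp1 : p < 1) {A : Finset α} {d : ℝ}
    (hd : ∀ v ∈ A, (#(A.filter (G.Adj v)) : ℝ) ≤ d) :
    (1 - p) ^ #A * indepPoly G A (p / (1 - p)) ≤
      Real.exp (-(p * (p / (1 - p)) * (degreeSum G A / 2) * (1 - 2 * d * (p / (1 - p))))) := by
  have hq : 0 < 1 - p := sub_pos.2 hp1
  have hx : 0 ≤ p / (1 - p) := by positivity
  have hpx : (1 - p) * (p / (1 - p)) = p := by field_simp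
  set x := p / (1 - p)
  induction A using Finset.induction with
  | empty => simp [indepPoly, degreeSum, filter_singleton]
  | insert v A hv ih =>
    have hd' : ∀ u ∈ insert v A, (#(A.filter (G.Adj u)) : ℝ) ≤ d := fun u hu =>
      le_trans (by exact_mod_cast card_le_card (filter_subset_filter _ (subset_insert _ _)))
        (hd u hu)
    have ih := ih fun u hu => hd' u (mem_insert_of_mem hu)
    have h1 := indepPoly_sdiff_le G hx (filter_subset (G.Adj v) A)
      fun u hu => hd' u (mem_insert_of_mem (mem_filter.1 hu).1)
    rw [← filter_not] at h1
    rw [indepPoly_insert G hv, degreeSum_insert G hv, card_insert_of_notMem hv]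
    have hh := hd' v (mem_insert_self _ _)
    set h : ℝ := ((#(A.filter (G.Adj v)) : ℕ) : ℝ)
    have hh0 : 0 ≤ h := by positivity
    have hA := indepPoly_nonneg G hx A
    have h2 : indepPoly G A x + x * indepPoly G (A.filter fun u => ¬ G.Adj v u) x ≤
        (1 + x - h * x ^ 2 * (1 - 2 * d * x)) * indepPoly G A x := by
      have h3 := mul_le_mul_of_nonneg_left h1 hx
      have h4 : 0 ≤ (d - h) * (h * x ^ 3 * indepPoly G A x) :=
        mul_nonneg (sub_nonneg.2 hh) (by positivity)
      linarith
    have h5 : (1 - p) * (1 + x - h * x ^ 2 * (1 - 2 * d * x)) =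
        1 - h * p * x * (1 - 2 * d * x) := by
      linear_combination (1 - h * x * (1 - 2 * d * x)) * hpx
    calc (1 - p) ^ (#A + 1) * (indepPoly G A x + _)
        ≤ (1 - p) ^ (#A + 1) * ((1 + x - h * x ^ 2 * (1 - 2 * d * x)) * indepPoly G A x) := by
          gcongr
      _ = (1 - h * p * x * (1 - 2 * d * x)) * ((1 - p) ^ #A * indepPoly G A x) := by
          rw [← h5]; ring
      _ ≤ Real.exp (-(h * p * x * (1 - 2 * d * x))) * ((1 - p) ^ #A * indepPoly G A x) := by
          gcongr
          linarith [Real.add_one_le_exp (-(h * p * x * (1 - 2 * d * x)))]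
      _ ≤ _ := mul_le_mul_of_nonneg_left ih (Real.exp_pos _).le
      _ = _ := by rw [← Real.exp_add]; congr 1; ring

lemma exp_neg_mul_le_one_sub {y ε : ℝ} (hy : 0 ≤ y) (hyε : y ≤ ε) (hε : ε ≤ 1 / 2) :
    Real.exp (-(y * (1 + 2 * ε))) ≤ 1 - y := by
  have h1 : 1 + y * (1 + 2 * ε) ≤ Real.exp (y * (1 + 2 * ε)) := by
    linarith [Real.add_one_le_exp (y * (1 + 2 * ε))]
  have h2 : 1 ≤ (1 - y) * (1 + y * (1 + 2 * ε)) := by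
    nlinarith [mul_nonneg hy (sub_nonneg.2 hyε), mul_nonneg hy (mul_nonneg hy (sub_nonneg.2 hε)),
      mul_nonneg hy (sub_nonneg.2 hε)]
  rw [Real.exp_neg, inv_le_iff_one_le_mul₀ (Real.exp_pos _)]
  exact h2.trans (mul_le_mul_of_nonneg_left h1 (by linarith))

lemma exp_le_indepPoly (hp0 : 0 ≤ p) (hp1 : p < 1) {A : Finset α} {ε : ℝ} (hε : ε ≤ 1 / 2)
    (hd : ∀ v ∈ A, p * (p / (1 - p)) * (#(A.filter (G.Adj v)) : ℝ) ≤ ε) :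
    Real.exp (-(p * (p / (1 - p)) * (degreeSum G A / 2) * (1 + 2 * ε))) ≤
      (1 - p) ^ #A * indepPoly G A (p / (1 - p)) := by
  have hq : 0 < 1 - p := sub_pos.2 hp1
  have hx : 0 ≤ p / (1 - p) := by positivity
  have hpx : (1 - p) * (p / (1 - p)) = p := by field_simp
  set x := p / (1 - p)
  induction A using Finset.induction with
  | empty => simp [indepPoly, degreeSum, filter_singleton]
  | insert v A hv ih =>
    have hd' : ∀ u ∈ insert v A, p * x * (#(A.filter (G.Adj u)) : ℝ) ≤ ε := fun u hu =>
      le_trans (mul_le_mul_of_nonneg_left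
        (by exact_mod_cast card_le_card (filter_subset_filter _ (subset_insert _ _)))
        (by positivity)) (hd u hu)
    have ih := ih fun u hu => hd' u (mem_insert_of_mem hu)
    have h1 := indepPoly_sdiff_ge G hx A (A.filter (G.Adj v))
    rw [← filter_not] at h1
    rw [indepPoly_insert G hv, degreeSum_insert G hv, card_insert_of_notMem hv]
    have hh := hd' v (mem_insert_self _ _)
    set h : ℝ := ((#(A.filter (G.Adj v)) : ℕ) : ℝ)
    have hh0 : 0 ≤ h := by positivity
    have hA := indepPoly_nonneg G hx A
    have h2 : (1 + x - h * x ^ 2) * indepPoly G A x ≤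
        indepPoly G A x + x * indepPoly G (A.filter fun u => ¬ G.Adj v u) x := by
      have h3 := mul_le_mul_of_nonneg_left h1 hx
      linarith
    have h5 : (1 - p) * (1 + x - h * x ^ 2) = 1 - p * x * h := by
      linear_combination (1 - h * x) * hpx
    calc _ = Real.exp (-(p * x * h * (1 + 2 * ε))) *
          Real.exp (-(p * x * (degreeSum G A / 2) * (1 + 2 * ε))) := by
          rw [← Real.exp_add]; congr 1; ring
      _ ≤ (1 - p * x * h) * ((1 - p) ^ #A * indepPoly G A x) :=
          mul_le_mul (exp_neg_mul_le_one_sub (by positivity) hh hε) ih (Real.exp_pos _).le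
            (by linarith)
      _ = (1 - p) ^ (#A + 1) * ((1 + x - h * x ^ 2) * indepPoly G A x) := by
          rw [← h5]; ring
      _ ≤ _ := by gcongr

end IndependencePolynomial

section Overlap

/-- The graph on all subsets of `Fin n` joining distinct sets that share at least two points. -/
def overlapGraph (n : ℕ) : SimpleGraph (Finset (Fin n)) where
  Adj e f := e ≠ f ∧ 2 ≤ #(e ∩ f)
  symm := ⟨fun e f h => ⟨h.1.symm, by rw [inter_comm]; exact h.2⟩⟩
  loopless := ⟨fun _ h => h.1 rfl⟩

instance (n : ℕ) : DecidableRel (overlapGraph n).Adj := fun e f =>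
  inferInstanceAs (Decidable (e ≠ f ∧ 2 ≤ #(e ∩ f)))

lemma isIndepSet_overlapGraph {n : ℕ} (H : Finset (Finset (Fin n))) :
    (overlapGraph n).IsIndepSet (H : Set (Finset (Fin n))) ↔ IsLinear H := by
  constructor
  · intro h e he f hf hef
    by_contra hc
    exact h he hf hef ⟨hef, by lia⟩
  · intro h e he f hf hef hadj
    have := h e he f hf hef
    have := hadj.2
    lia

lemma probLinear_eq_indepPoly (n r : ℕ) {p : ℝ} (hp : p < 1) :
    probLinear n r p = (1 - p) ^ #(powersetCard r (univ : Finset (Fin n))) *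
      indepPoly (overlapGraph n) (powersetCard r univ) (p / (1 - p)) := by
  have hq : 1 - p ≠ 0 := (sub_pos.2 hp).ne'
  unfold probLinear indepPoly
  rw [mul_sum, card_powersetCard, card_univ, Fintype.card_fin]
  refine sum_congr ?_ fun H hH => ?_
  · ext H
    simp [isIndepSet_overlapGraph, subset_iff, mem_powersetCard]
  · have hle := card_le_card (mem_powerset.1 (mem_filter.1 hH).1)
    rw [card_powersetCard, card_univ, Fintype.card_fin] at hle
    rw [div_pow, ← Nat.sub_add_cancel hle, pow_add, Nat.add_sub_cancel]
    field_simp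

lemma sum_choose_card_inter {n r k : ℕ} {e : Finset (Fin n)} (he : #e = r) (hk : k ≤ r) :
    ∑ f ∈ powersetCard r univ, (#(e ∩ f)).choose k = r.choose k * (n - k).choose (r - k) := by
  have h1 : ∀ f ∈ powersetCard r (univ : Finset (Fin n)), (#(e ∩ f)).choose k =
      ∑ s ∈ powersetCard k e, if s ⊆ f then 1 else 0 := by
    intro f _
    rw [← card_powersetCard, ← card_filter]
    congr 1
    ext s
    simp only [mem_powersetCard, mem_filter, subset_inter_iff]
    tauto
  rw [sum_congr rfl h1, sum_comm]
  have h2 : ∀ s ∈ powersetCard k e,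
      (∑ f ∈ powersetCard r (univ : Finset (Fin n)), if s ⊆ f then 1 else 0) =
        (n - k).choose (r - k) := by
    intro s hs
    have hs := (mem_powersetCard.1 hs).2
    rw [← card_filter, card_filter_powersetCard_subset _ _ _ (subset_univ _) (hs ▸ hk), hs,
      card_univ, Fintype.card_fin]
  rw [sum_congr rfl h2, sum_const, card_powersetCard, he, smul_eq_mul]

lemma degree_overlapGraph_le {n r : ℕ} {e : Finset (Fin n)} (he : #e = r) (hr : 2 ≤ r) :
    #((powersetCard r univ).filter ((overlapGraph n).Adj e)) ≤
      r.choose 2 * (n - 2).choose (r - 2) := by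
  rw [← sum_choose_card_inter he hr, card_filter]
  refine sum_le_sum fun f _ => ?_
  split_ifs with h
  · exact Nat.choose_pos h.2
  · exact Nat.zero_le _

lemma le_degree_overlapGraph {n r : ℕ} {e : Finset (Fin n)} (he : #e = r) (hr : 3 ≤ r) :
    r.choose 2 * (n - 2).choose (r - 2) ≤
      #((powersetCard r univ).filter ((overlapGraph n).Adj e)) +
        3 * (r.choose 3 * (n - 3).choose (r - 3)) := by
  rw [← sum_choose_card_inter he (by lia : 2 ≤ r), ← sum_choose_card_inter he hr, card_filter,
    mul_sum, ← sum_add_distrib]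
  refine sum_le_sum fun f _ => ?_
  have h3 := Nat.choose_succ_right_eq (#(e ∩ f)) 2
  rcases lt_trichotomy (#(e ∩ f)) 2 with h | h | h
  · simp [Nat.choose_eq_zero_of_lt h]
  · have hef : e ≠ f := by
      rintro rfl
      rw [inter_self] at h
      lia
    rw [if_pos ⟨hef, h.ge⟩, h]
    simp
  · have : (#(e ∩ f)).choose 2 * 1 ≤ (#(e ∩ f)).choose 2 * (#(e ∩ f) - 2) :=
      Nat.mul_le_mul_left _ (by lia)
    lia

end Overlap

section Estimates

lemma cast_choose_three {n : ℕ} (hn : 3 ≤ n) :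
    (n.choose 3 : ℝ) = n * (n - 1) * (n - 2) / 6 := by
  have h : ((n.choose 3 * 3 : ℕ) : ℝ) = ((n.choose 2 * (n - 2) : ℕ) : ℝ) := by
    exact_mod_cast Nat.choose_succ_right_eq n 2
  push_cast [Nat.cast_choose_two, Nat.cast_sub (by lia : 2 ≤ n)] at h
  linarith

lemma degree_overlapGraph_bounds {n r : ℕ} {e : Finset (Fin n)} (he : #e = r) (hr : 3 ≤ r)
    (hn : 6 ≤ n) :
    (n.choose r : ℝ) * ((r * (r - 1)) ^ 2 / (2 * n ^ 2) - r ^ 6 / n ^ 3) ≤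
        #((powersetCard r univ).filter ((overlapGraph n).Adj e)) ∧
      (#((powersetCard r univ).filter ((overlapGraph n).Adj e)) : ℝ) ≤
        n.choose r * ((r * (r - 1)) ^ 2 / (2 * (n * (n - 1)))) := by
  have hr' : (3 : ℝ) ≤ r := by exact_mod_cast hr
  have hn' : (6 : ℝ) ≤ n := by exact_mod_cast hn
  have n1 : (0 : ℝ) < n - 1 := by linarith
  have n2 : (0 : ℝ) < n - 2 := by linarith
  have n0 : (0 : ℝ) < n := by linarith
  have h2 : ((n.choose r * r.choose 2 : ℕ) : ℝ) = _ :=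
    congrArg Nat.cast (Nat.choose_mul (n := n) (by lia : 2 ≤ r))
  have h3 : ((n.choose r * r.choose 3 : ℕ) : ℝ) = _ :=
    congrArg Nat.cast (Nat.choose_mul (n := n) hr)
  push_cast [Nat.cast_choose_two, cast_choose_three hr, cast_choose_three (by lia : 3 ≤ n)]
    at h2 h3
  have hP : ((n - 2).choose (r - 2) : ℝ) = n.choose r * (r * (r - 1)) / (n * (n - 1)) := by
    field_simp
    linarith
  have hQ : ((n - 3).choose (r - 3) : ℝ) =
      n.choose r * (r * (r - 1) * (r - 2)) / (n * (n - 1) * (n - 2)) := by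
    field_simp
    linarith
  have hU : ((_ : ℕ) : ℝ) ≤ ((_ : ℕ) : ℝ) :=
    Nat.cast_le.2 (degree_overlapGraph_le he (by lia : 2 ≤ r))
  have hL : ((_ : ℕ) : ℝ) ≤ ((_ : ℕ) : ℝ) := Nat.cast_le.2 (le_degree_overlapGraph he hr)
  push_cast [Nat.cast_choose_two, cast_choose_three hr, hP, hQ] at hU hL
  have h11 : (r : ℝ) * (r - 1) / 2 * (n.choose r * (r * (r - 1)) / (n * (n - 1))) =
      n.choose r * ((r * (r - 1)) ^ 2 / (2 * (n * (n - 1)))) := by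
    field_simp
  constructor
  · have h4 : ((r : ℝ) * (r - 1)) ^ 2 / (2 * n ^ 2) ≤
        (r * (r - 1)) ^ 2 / (2 * (n * (n - 1))) := by
      gcongr
      nlinarith
    have h5 : ((r : ℝ) * (r - 1) * (r - 2)) ^ 2 / (2 * (n * (n - 1) * (n - 2))) ≤
        r ^ 6 / n ^ 3 := by
      have h6 : (0 : ℝ) ≤ r - 1 := by linarith
      have h7 : (0 : ℝ) ≤ r - 2 := by linarith
      have h8 : (r : ℝ) * (r - 1) * (r - 2) ≤ r * r * r := by gcongr <;> linarith
      have h9 : ((r : ℝ) * (r - 1) * (r - 2)) ^ 2 ≤ r ^ 6 :=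
        (pow_le_pow_left₀ (by positivity) h8 2).trans_eq (by ring)
      gcongr
      nlinarith [mul_nonneg n0.le (sub_nonneg.2 hn')]
    have h10 := mul_le_mul_of_nonneg_left (sub_le_sub h4 h5) (Nat.cast_nonneg (α := ℝ) (n.choose r))
    refine h10.trans ?_
    have h12 : 3 * ((r : ℝ) * (r - 1) * (r - 2) / 6 *
        (n.choose r * (r * (r - 1) * (r - 2)) / (n * (n - 1) * (n - 2)))) =
        n.choose r * ((r * (r - 1) * (r - 2)) ^ 2 / (2 * (n * (n - 1) * (n - 2)))) := by
      field_simp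
      ring
    rw [h11, h12] at hL
    linarith
  · exact hU.trans_eq h11

lemma mul_pred_le_choose_mul_sq {n r : ℕ} (hr : 2 ≤ r) (hrn : r ≤ n) :
    (n : ℝ) * (n - 1) ≤ n.choose r * r ^ 2 := by
  have hn : (2 : ℝ) ≤ n := by exact_mod_cast hr.trans hrn
  have h2 : ((n.choose r * r.choose 2 : ℕ) : ℝ) = _ :=
    congrArg Nat.cast (Nat.choose_mul (n := n) hr)
  have h3 : (1 : ℝ) ≤ (n - 2).choose (r - 2) := by
    exact_mod_cast Nat.choose_pos (by lia : r - 2 ≤ n - 2)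
  push_cast [Nat.cast_choose_two] at h2
  have h4 := mul_le_mul_of_nonneg_left h3
    (mul_nonneg (by linarith) (by linarith) : (0 : ℝ) ≤ n * (n - 1))
  have h5 : (0 : ℝ) ≤ n.choose r * r := by positivity
  linarith

/-- Bounds on the proportion of `r`-sets sharing at least two points with a given one. -/
lemma overlap_proportion_bounds {n r : ℝ} (hn : 2 ≤ n) (hr : 1 ≤ r) :
    (r * (r - 1)) ^ 2 / (2 * (n * (n - 1))) ≤ r ^ 4 / n ^ 2 ∧
      (r * (r - 1)) ^ 2 / (2 * (n * (n - 1))) ≤ (r * (r - 1)) ^ 2 / (2 * n ^ 2) + r ^ 6 / n ^ 3 := by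
  have n0 : 0 < n := by linarith
  have n1 : 0 < n - 1 := by linarith
  obtain ⟨a, ha⟩ : ∃ a : ℝ, a = r * (r - 1) := ⟨_, rfl⟩
  have ha0 : 0 ≤ a := ha ▸ mul_nonneg (by linarith) (by linarith)
  have har : a ≤ r ^ 2 := by rw [ha]; nlinarith
  have ha2 : a ^ 2 ≤ r ^ 4 := (pow_le_pow_left₀ ha0 har 2).trans_eq (by ring)
  have hr46 : r ^ 4 ≤ r ^ 6 := pow_le_pow_right₀ hr (by norm_num)
  rw [← ha]
  constructor
  · gcongr
    nlinarith
  · have h1 : a ^ 2 / (2 * (n * (n - 1))) - a ^ 2 / (2 * n ^ 2) =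
        a ^ 2 / (2 * n ^ 2 * (n - 1)) := by
      field_simp
      ring
    have h2 : a ^ 2 / (2 * n ^ 2 * (n - 1)) ≤ r ^ 6 / n ^ 3 := by
      gcongr
      · exact ha2.trans hr46
      · nlinarith [mul_nonneg (sq_nonneg n) (sub_nonneg.2 hn)]
    linarith

lemma degreeSum_overlapGraph_bounds {n r : ℕ} (hr : 3 ≤ r) (hn : 6 ≤ n) :
    (n.choose r : ℝ) ^ 2 * ((r * (r - 1)) ^ 2 / (2 * n ^ 2) - r ^ 6 / n ^ 3) ≤
        degreeSum (overlapGraph n) (powersetCard r univ) ∧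
      degreeSum (overlapGraph n) (powersetCard r univ) ≤
        (n.choose r : ℝ) ^ 2 * ((r * (r - 1)) ^ 2 / (2 * (n * (n - 1)))) := by
  have hcard : (#(powersetCard r (univ : Finset (Fin n))) : ℝ) = n.choose r := by simp
  have hdeg : ∀ e ∈ powersetCard r (univ : Finset (Fin n)), _ := fun e he =>
    degree_overlapGraph_bounds (mem_powersetCard.1 he).2 hr hn
  have hsq : ∀ y : ℝ, (n.choose r : ℝ) ^ 2 * y =
      #(powersetCard r (univ : Finset (Fin n))) • (n.choose r * y) := fun y => by
    rw [nsmul_eq_mul, hcard]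
    ring
  rw [hsq, hsq]
  exact ⟨card_nsmul_le_sum _ _ _ fun e he => (hdeg e he).1,
    sum_le_card_nsmul _ _ _ fun e he => (hdeg e he).2⟩

/-- Comparison of the exponent `p * x * S / 2` with its asymptotic value. -/
lemma exponent_bounds {n r N p c x S a : ℝ} (hn : 0 < n) (hr : 0 < r) (hp : 0 ≤ p)
    (hc : 0 ≤ c) (hS : 0 ≤ S) (hpx : p ≤ x) (hx : x ≤ p * (1 + 2 * p)) (hp1 : p ≤ 1 / 2)
    (hpκ : p ≤ 2 * c * (r ^ 2 / n)) (hSU : S ≤ N ^ 2 * (r ^ 4 / n ^ 2))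
    (hSU1 : S ≤ N ^ 2 * (a ^ 2 / (2 * n ^ 2) + r ^ 6 / n ^ 3))
    (hSL : N ^ 2 * (a ^ 2 / (2 * n ^ 2) - r ^ 6 / n ^ 3) ≤ S) :
    p * x * (S / 2) * (r ^ 2 / n) ≤ r ^ 6 * (N * p) ^ 2 / n ^ 3 ∧
    p * x * (S / 2) ≤
      a ^ 2 * (N * p) ^ 2 / (4 * n ^ 2) + (1 / 2 + 2 * c) * (r ^ 6 * (N * p) ^ 2 / n ^ 3) ∧
    a ^ 2 * (N * p) ^ 2 / (4 * n ^ 2) - (1 / 2) * (r ^ 6 * (N * p) ^ 2 / n ^ 3) ≤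
      p * x * (S / 2) := by
  have hpS : p ^ 2 * S * (r ^ 2 / n) ≤ r ^ 6 * (N * p) ^ 2 / n ^ 3 := by
    calc p ^ 2 * S * (r ^ 2 / n) ≤ p ^ 2 * (N ^ 2 * (r ^ 4 / n ^ 2)) * (r ^ 2 / n) := by gcongr
      _ = _ := by field_simp
  have hlow : p ^ 2 * S / 2 ≤ p * x * (S / 2) := by
    have h1 : p * p * (S / 2) ≤ p * x * (S / 2) := by gcongr
    linarith
  have hup : p * x * (S / 2) ≤ p ^ 2 * S / 2 + p ^ 2 * S * p := by
    have h1 : p * x * (S / 2) ≤ p * (p * (1 + 2 * p)) * (S / 2) := by gcongr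
    linarith
  refine ⟨?_, ?_, ?_⟩
  · refine le_trans ?_ hpS
    have h1 : p ^ 2 * S * p ≤ p ^ 2 * S * (1 / 2) := by gcongr
    exact mul_le_mul_of_nonneg_right (by linarith) (by positivity)
  · have h1 : p ^ 2 * S / 2 ≤ p ^ 2 * (N ^ 2 * (a ^ 2 / (2 * n ^ 2) + r ^ 6 / n ^ 3)) / 2 := by
      gcongr
    have h2 : p ^ 2 * S * p ≤ p ^ 2 * S * (2 * c * (r ^ 2 / n)) := by gcongr
    have h3 := mul_le_mul_of_nonneg_left hpS (by linarith : 0 ≤ 2 * c)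
    have h4 : p ^ 2 * (N ^ 2 * (a ^ 2 / (2 * n ^ 2) + r ^ 6 / n ^ 3)) / 2 =
        a ^ 2 * (N * p) ^ 2 / (4 * n ^ 2) + (1 / 2) * (r ^ 6 * (N * p) ^ 2 / n ^ 3) := by ring
    linarith
  · have h1 : p ^ 2 * (N ^ 2 * (a ^ 2 / (2 * n ^ 2) - r ^ 6 / n ^ 3)) / 2 ≤ p ^ 2 * S / 2 := by
      gcongr
    have h4 : p ^ 2 * (N ^ 2 * (a ^ 2 / (2 * n ^ 2) - r ^ 6 / n ^ 3)) / 2 =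
        a ^ 2 * (N * p) ^ 2 / (4 * n ^ 2) - (1 / 2) * (r ^ 6 * (N * p) ^ 2 / n ^ 3) := by ring
    linarith

/-- The expected number of edges meeting a fixed edge in at least two points is small, and the
odds ratio `p / (1 - p)` is comparable to `p`. -/
lemma edge_density_bounds {n N r p c : ℝ} (hr : 3 ≤ r) (hp : 0 ≤ p) (hc : 1 ≤ c)
    (hn : 8 * c ^ 2 ≤ n) (hNr : n * (n - 1) ≤ N * r ^ 2) (hm : N * p * r ^ 2 ≤ c * n) :
    p * n ≤ 2 * c ∧ p ≤ 1 / 4 ∧ p ≤ 2 * c * (r ^ 2 / n) ∧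
      p * (N * (r ^ 4 / n ^ 2)) ≤ c * (r ^ 2 / n) := by
  have hn8 : 8 ≤ n := by nlinarith
  have hn8c : 8 * c ≤ n := by nlinarith
  have n0 : 0 < n := by linarith
  have hpn : p * n ≤ 2 * c := by
    have h1 := mul_le_mul_of_nonneg_right hNr hp
    have h3 := le_of_mul_le_mul_left (by linarith : n * ((n - 1) * p) ≤ n * c) n0
    nlinarith
  refine ⟨hpn, by nlinarith, ?_, ?_⟩
  · rw [← mul_div_assoc, le_div_iff₀ n0]
    have h1 : 1 ≤ r ^ 2 := by nlinarith
    nlinarith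
  · calc p * (N * (r ^ 4 / n ^ 2)) = N * p * r ^ 2 * (r ^ 2 / n ^ 2) := by ring
      _ ≤ c * n * (r ^ 2 / n ^ 2) := by gcongr
      _ = _ := by field_simp

lemma probLinear_estimate {n r : ℕ} {p c : ℝ} (hr : 3 ≤ r) (hp : 0 ≤ p) (hc : 1 ≤ c)
    (hn : 8 * c ^ 2 ≤ n) (hpos : 0 < n.choose r * p) (hm : n.choose r * p ≤ c * (n / r ^ 2)) :
    ∃ err : ℝ,
      probLinear n r p = Real.exp (-((r.descFactorial 2 : ℝ) ^ 2 * (n.choose r * p) ^ 2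
        / (4 * (n : ℝ) ^ 2)) + err) ∧
      |err| ≤ (1 + 16 * c + 8 * c ^ 2) * (r : ℝ) ^ 6 * (n.choose r * p) ^ 2 / (n : ℝ) ^ 3 := by
  have hr' : (3 : ℝ) ≤ r := by exact_mod_cast hr
  have hn8 : (8 : ℝ) ≤ n := by nlinarith
  have hn6 : 6 ≤ n := by
    have : (6 : ℝ) ≤ n := by linarith
    exact_mod_cast this
  have n0 : (0 : ℝ) < n := by linarith
  have hrn : r ≤ n := by
    by_contra h
    rw [Nat.choose_eq_zero_of_lt (by lia)] at hpos
    simp at hpos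
  have hmr : n.choose r * p * r ^ 2 ≤ c * n := by
    rwa [← mul_div_assoc, le_div_iff₀ (by positivity)] at hm
  obtain ⟨hpn, hp14, hpκ, hpd⟩ := edge_density_bounds hr' hp hc hn
    (mul_pred_le_choose_mul_sq (by lia) hrn) hmr
  have hp1 : p < 1 := by linarith
  obtain ⟨hq, hq'⟩ := overlap_proportion_bounds (by linarith : (2 : ℝ) ≤ n)
    (by linarith : (1 : ℝ) ≤ r)
  have hdeg : ∀ e ∈ powersetCard r (univ : Finset (Fin n)),
      (#((powersetCard r univ).filter ((overlapGraph n).Adj e)) : ℝ) ≤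
        n.choose r * (r ^ 4 / n ^ 2) := fun e he =>
    (degree_overlapGraph_bounds (mem_powersetCard.1 he).2 hr hn6).2.trans (by gcongr)
  have hdegN : ∀ e ∈ powersetCard r (univ : Finset (Fin n)),
      (#((powersetCard r univ).filter ((overlapGraph n).Adj e)) : ℝ) ≤ n.choose r := by
    intro e _
    have h := card_filter_le (powersetCard r univ) ((overlapGraph n).Adj e)
    rw [card_powersetCard, card_univ, Fintype.card_fin] at h
    exact_mod_cast h
  obtain ⟨hSL, hSU⟩ := degreeSum_overlapGraph_bounds hr hn6
  have hS0 : 0 ≤ degreeSum (overlapGraph n) (powersetCard r univ) :=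
    sum_nonneg fun _ _ => Nat.cast_nonneg _
  have hlow := exp_le_indepPoly (overlapGraph n) hp hp1 (A := powersetCard r univ)
    (ε := 2 * c * p) (by nlinarith)
  have hup := indepPoly_le_exp (overlapGraph n) hp hp1 (A := powersetCard r univ) hdeg
  rw [← probLinear_eq_indepPoly n r hp1] at hlow hup
  rw [Nat.cast_descFactorial_two]
  generalize degreeSum (overlapGraph n) (powersetCard r univ) = S at *
  generalize (n.choose r : ℝ) = N at *
  have hN0 : 0 ≤ N := (pos_of_mul_pos_left hpos hp).le
  have hxp : p / (1 - p) * (1 - p) = p := div_mul_cancel₀ _ (sub_pos.2 hp1).ne'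
  have hx0 : 0 ≤ p / (1 - p) := div_nonneg hp (sub_pos.2 hp1).le
  generalize p / (1 - p) = x at *
  have hpx : p ≤ x := by nlinarith
  have hx2 : x ≤ 2 * p := by nlinarith
  have hxx : x ≤ p * (1 + 2 * p) := by nlinarith
  obtain ⟨hTκ, hTM, hMT⟩ := exponent_bounds n0 (by linarith) hp (by linarith) hS0 hpx hxx
    (by linarith) hpκ (hSU.trans (by gcongr)) (hSU.trans (by gcongr)) hSL
  have hlow := hlow fun e he => by
    have hD0 : (0 : ℝ) ≤ #((powersetCard r univ).filter ((overlapGraph n).Adj e)) :=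
      Nat.cast_nonneg _
    have h1 := hdeg e he
    have h2 := hdegN e he
    generalize (#((powersetCard r univ).filter ((overlapGraph n).Adj e)) : ℝ) = D at *
    have h3 : p * D ≤ c := by
      refine (mul_self_le_mul_self_iff (by positivity) (by linarith)).2 ?_
      have h4 : N * p * (r ^ 2 / n) ≤ c := by rwa [← mul_div_assoc, div_le_iff₀ n0]
      calc p * D * (p * D) ≤ p * N * (p * (N * (r ^ 4 / n ^ 2))) := by gcongr
        _ ≤ p * N * (c * (r ^ 2 / n)) := by gcongr
        _ = c * (N * p * (r ^ 2 / n)) := by ring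
        _ ≤ c * c := by gcongr
    have h5 := mul_le_mul hx2 h3 (by positivity) (by linarith)
    linarith
  have hP0 : 0 < probLinear n r p := (Real.exp_pos _).trans_le hlow
  have hlog1 := (Real.le_log_iff_exp_le hP0).2 hlow
  have hlog2 := (Real.log_le_iff_le_exp hP0).2 hup
  refine ⟨Real.log (probLinear n r p) + (r * (r - 1)) ^ 2 * (N * p) ^ 2 / (4 * n ^ 2), ?_, ?_⟩
  · rw [neg_add_cancel_comm_assoc, Real.exp_log hP0]
  have hT0 : 0 ≤ p * x * (S / 2) := by positivity
  have hE0 : 0 ≤ r ^ 6 * (N * p) ^ 2 / (n : ℝ) ^ 3 := by positivity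
  have hd0 : 0 ≤ N * ((r : ℝ) ^ 4 / n ^ 2) := by positivity
  have hb : (1 + 16 * c + 8 * c ^ 2) * (r : ℝ) ^ 6 * (N * p) ^ 2 / (n : ℝ) ^ 3 =
      (1 + 16 * c + 8 * c ^ 2) * (r ^ 6 * (N * p) ^ 2 / n ^ 3) := by ring
  rw [hb]
  generalize (r * (r - 1)) ^ 2 * (N * p) ^ 2 / (4 * (n : ℝ) ^ 2) = M at *
  generalize r ^ 6 * (N * p) ^ 2 / (n : ℝ) ^ 3 = E at *
  generalize p * x * (S / 2) = T at *
  generalize N * ((r : ℝ) ^ 4 / n ^ 2) = d at *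
  generalize (r : ℝ) ^ 2 / n = κ at *
  have hcE : 0 ≤ c * E := by positivity
  have hccE : 0 ≤ c ^ 2 * E := by positivity
  rw [abs_le]
  constructor
  · have h1 : T * (4 * c * p) ≤ T * (4 * c * (2 * c * κ)) := by gcongr
    have h2 := mul_le_mul_of_nonneg_left hTκ (by positivity : 0 ≤ 8 * c ^ 2)
    linarith
  · have h1 : d * x ≤ d * (2 * p) := by gcongr
    have h2 : T * (2 * (d * x)) ≤ T * (4 * (c * κ)) :=
      mul_le_mul_of_nonneg_left (by linarith) hT0
    have h3 := mul_le_mul_of_nonneg_left hTκ (by positivity : 0 ≤ 4 * c)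
    linarith

end Estimates

/-- **Theorem 9.8**: if `0 < m₀ = O(r⁻²n)` then
`P[H_r(n,p) linear] = exp(-[r]₂²m₀²/(4n²) + O(r⁶m₀²/n³))`. -/
theorem statement19 (r : ℕ → ℕ) (p : ℕ → ℝ) (hr : ∀ n, 3 ≤ r n)
    (hp0 : ∀ n, 0 ≤ p n) (hp1 : ∀ n, p n ≤ 1)
    (hpos : ∀ᶠ n in atTop, 0 < expEdges r p n)
    (hO : (fun n => expEdges r p n) =O[atTop] (fun n => (n : ℝ) / (r n : ℝ) ^ 2)) :
    ∃ C > (0 : ℝ), ∃ n₀ : ℕ, ∀ n ≥ n₀, ∃ err : ℝ,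
      probLinear n (r n) (p n)
        = Real.exp (-(((r n).descFactorial 2 : ℝ) ^ 2 * (expEdges r p n) ^ 2
            / (4 * (n : ℝ) ^ 2)) + err) ∧
      |err| ≤ C * (r n : ℝ) ^ 6 * (expEdges r p n) ^ 2 / (n : ℝ) ^ 3 := by
  obtain ⟨c, hc⟩ := hO.bound
  refine ⟨1 + 16 * max c 1 + 8 * max c 1 ^ 2, by positivity, ?_⟩
  obtain ⟨n₀, hn₀⟩ := eventually_atTop.1
    ((hc.and hpos).and (tendsto_natCast_atTop_atTop.eventually_ge_atTop (8 * max c 1 ^ 2)))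
  refine ⟨n₀, fun n hn => ?_⟩
  obtain ⟨⟨h1, h2⟩, h3⟩ := hn₀ n hn
  refine probLinear_estimate (hr n) (hp0 n) (le_max_right c 1) h3 h2 ?_
  rw [Real.norm_of_nonneg h2.le, Real.norm_of_nonneg (by positivity)] at h1
  exact h1.trans (by gcongr; exact le_max_left c 1)
end
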